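/- Let (Ω, P) be a probability space, let (U, μ) be a measure space, let g : U → ℂ be μ-integrable, and let κ ∈ ℝ and σ ≥ 0. Suppose h : Ω × U → ℝ is jointly measurable and, for μ-almost every u ∈ U, the random variable ω ↦ h(ω, u) has the Gaussian distribution N(0, σ²). Then ∫_Ω ( ∫_U g(u) · exp(-iκ · h(ω, u)) dμ(u) ) dP(ω) = exp(-σ²κ²/2) · ∫_U g(u) dμ(u). -/

import Mathlib

open MeasureTheory ProbabilityTheory

/-- The expected random phase of a centred Gaussian variable. -/
theorem integral_cexp_neg_I_mul_of_map_eq_gaussianReal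
    {Ω : Type*} [MeasurableSpace Ω] {P : Measure Ω} {X : Ω → ℝ} (hX : AEMeasurable X P)
    {κ σ : ℝ} (hlaw : Measure.map X P = gaussianReal 0 (Real.toNNReal (σ ^ 2))) :
    ∫ ω, Complex.exp (-Complex.I * κ * X ω) ∂P = Complex.exp (-(σ ^ 2 * κ ^ 2) / 2) := by
  have hchar := charFun_gaussianReal (μ := 0) (v := Real.toNNReal (σ ^ 2)) (-κ)
  rw [← hlaw, charFun_apply_real, integral_map hX (by fun_prop)] at hchar
  convert hchar using 1
  · congr with ω
    congr 1
    push_cast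
    ring
  · congr 1
    rw [Real.coe_toNNReal _ (sq_nonneg σ)]
    push_cast
    ring

theorem norm_cexp_neg_I_mul_ofReal_mul_ofReal (κ x : ℝ) :
    ‖Complex.exp (-Complex.I * κ * x)‖ = 1 := by
  simp [Complex.norm_exp]

/-- A phase perturbation preserves integrability over the product with a finite measure space. -/
theorem MeasureTheory.Integrable.mul_cexp_phase_prod
    {Ω : Type*} [MeasurableSpace Ω] {P : Measure Ω} [IsFiniteMeasure P]
    {U : Type*} [MeasurableSpace U] {μ : Measure U} [SFinite μ]
    {g : U → ℂ} (hg : Integrable g μ) (κ : ℝ) {h : Ω × U → ℝ} (hmeas : Measurable h) :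
    Integrable (fun z : Ω × U => g z.2 * Complex.exp (-Complex.I * κ * h z)) (P.prod μ) :=
  (hg.comp_snd P).mul_bdd (c := 1) (by fun_prop)
    (.of_forall fun z => (norm_cexp_neg_I_mul_ofReal_mul_ofReal κ (h z)).le)

/-- The s-finite case of `expected_huygens_integral`. -/
theorem expected_huygens_integral_of_sFinite
    {Ω : Type*} [MeasurableSpace Ω] {P : Measure Ω} [IsFiniteMeasure P]
    {U : Type*} [MeasurableSpace U] {μ : Measure U} [SFinite μ]
    {g : U → ℂ} (hg : Integrable g μ) {κ σ : ℝ}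
    {h : Ω × U → ℝ} (hmeas : Measurable h)
    (hlaw : ∀ᵐ u ∂μ, Measure.map (fun ω => h (ω, u)) P
      = gaussianReal 0 (Real.toNNReal (σ ^ 2))) :
    ∫ ω, (∫ u, g u * Complex.exp (-Complex.I * κ * h (ω, u)) ∂μ) ∂P
      = Complex.exp (-(σ ^ 2 * κ ^ 2) / 2) * ∫ u, g u ∂μ := by
  rw [integral_integral_swap (hg.mul_cexp_phase_prod κ hmeas), ← integral_const_mul]
  refine integral_congr_ae ?_
  filter_upwards [hlaw] with u hu
  rw [integral_const_mul, integral_cexp_neg_I_mul_of_map_eq_gaussianReal (by fun_prop) hu,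
    mul_comm]

/-- Analytical core of the paper's Theorem 1: if a Huygens–Fresnel-type integrand
`g(u)` is perturbed by a random phase `exp(-iκ h(ω,u))` where, for μ-a.e. `u`, the
surface height `ω ↦ h(ω,u)` is Gaussian `N(0, σ²)`, then the expected value of the
integral equals `exp(-σ²κ²/2)` times the unperturbed integral. -/
theorem expected_huygens_integral
    {Ω : Type*} [MeasurableSpace Ω] (P : Measure Ω) [IsProbabilityMeasure P]
    {U : Type*} [MeasurableSpace U] (μ : Measure U)
    (g : U → ℂ) (hg : Integrable g μ)
    (κ σ : ℝ) (hσ : 0 ≤ σ)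
    (h : Ω × U → ℝ) (hmeas : Measurable h)
    (hlaw : ∀ᵐ u ∂μ, Measure.map (fun ω => h (ω, u)) P
      = gaussianReal 0 (Real.toNNReal (σ ^ 2))) :
    ∫ ω, (∫ u, g u * Complex.exp (-Complex.I * κ * h (ω, u)) ∂μ) ∂P
      = Complex.exp (-(σ ^ 2 * κ ^ 2) / 2) * ∫ u, g u ∂μ := by
  have hfin := hg.aefinStronglyMeasurable
  set s := hfin.sigmaFiniteSet
  have hzero : ∀ᵐ u ∂μ, u ∉ s → g u = 0 :=
    (ae_restrict_iff' hfin.measurableSet.compl).1 hfin.ae_eq_zero_compl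
  have hrestrict (f : U → ℂ) : ∫ u in s, g u * f u ∂μ = ∫ u, g u * f u ∂μ :=
    setIntegral_eq_integral_of_ae_compl_eq_zero (hzero.mono fun u hu hus => by simp [hu hus])
  have hmain := expected_huygens_integral_of_sFinite (κ := κ) (hg.restrict (s := s)) hmeas
    (ae_restrict_of_ae hlaw)
  have hone := hrestrict 1
  simp only [Pi.one_apply, mul_one] at hone
  simpa only [hrestrict, hone] using hmain
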